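/- arXiv:2601.02168 — 11 statements merged into one kernel-verified Lean document; each statement's English description precedes it below -/
import Mathlib

section
/- Suppose S, I, H, D : ℝ → ℝ are differentiable functions satisfying for all t ≥ 0 the SISHD system S'(t) = Λ - βI(t)S(t) - βεH(t)S(t) + αI·I(t) - μS(t) + αH·H(t), I'(t) = βI(t)S(t) + βεH(t)S(t) - (αI+γI+μ+δ)I(t), H'(t) = δI(t) - (γH+μ+αH)H(t), D'(t) = γI·I(t) + γH·H(t), with nonnegative initial data S(0) ≥ 0, I(0) ≥ 0, H(0) ≥ 0, D(0) ≥ 0. Then S(t) ≥ 0, I(t) ≥ 0, H(t) ≥ 0 and D(t) ≥ 0 for all t ≥ 0; i.e., the nonnegative orthant ℝ⁴₊ is positively invariant for the SISHD system. -/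
lemma neg_part_sq_hasDerivAt (x : ℝ) :
    HasDerivAt (fun y : ℝ => (max (-y) 0) ^ 2) (-2 * max (-x) 0) x := by
  rcases lt_trichotomy x 0 with h | h | h
  · have h1 : HasDerivAt (fun y : ℝ => y ^ 2) (-2 * max (-x) 0) x := by
      have := hasDerivAt_pow 2 x
      rw [max_eq_left (by linarith)]
      simpa using this
    apply h1.congr_of_eventuallyEq
    filter_upwards [gt_mem_nhds h] with y hy
    rw [max_eq_left (by linarith)]
    ring
  · subst h
    rw [hasDerivAt_iff_isLittleO]
    simp only [neg_zero, max_self, mul_zero, smul_zero, sub_zero]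
    have h2 : (fun y : ℝ => y ^ 2) =o[nhds 0] (fun y : ℝ => y) := by
      simpa using Asymptotics.isLittleO_pow_pow (𝕜 := ℝ) (m := 1) (n := 2) (by norm_num)
    refine Asymptotics.IsBigO.trans_isLittleO (Asymptotics.IsBigO.of_bound 1 ?_) h2
    refine Filter.Eventually.of_forall fun y => ?_
    rcases le_total y 0 with hy | hy
    · rw [max_eq_left (by linarith)]; simp
    · rw [max_eq_right (by linarith)]; simp; positivity
  · have h1 : HasDerivAt (fun _ : ℝ => (0:ℝ)) (-2 * max (-x) 0) x := by
      rw [max_eq_right (by linarith)]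
      simpa using hasDerivAt_const x (0:ℝ)
    apply h1.congr_of_eventuallyEq
    filter_upwards [lt_mem_nhds h] with y hy
    rw [max_eq_right (by linarith)]
    ring

lemma neg_part_facts (x M : ℝ) (h : |x| ≤ M) :
    0 ≤ max (-x) 0 ∧ max (-x) 0 * x = -(max (-x) 0) ^ 2 ∧ -x ≤ max (-x) 0 ∧
      max (-x) 0 ≤ M ∧ x + max (-x) 0 ≤ M := by
  have := abs_le.mp h
  have := abs_nonneg x
  rcases le_total x 0 with hy | hy
  · rw [max_eq_left (by linarith)]
    refine ⟨by linarith, by ring, by linarith, by linarith, by linarith⟩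
  · rw [max_eq_right (by linarith)]
    refine ⟨by linarith, by ring, by linarith, by linarith, by linarith⟩

lemma sishd_energy (Λ μ β ε αI γI δ γH αH M s i h p q r : ℝ)
    (hΛ : 0 < Λ) (hμ : 0 < μ) (hβ : 0 < β) (hαI : 0 < αI) (hγI : 0 < γI)
    (hδ : 0 < δ) (hγH : 0 < γH) (hαH : 0 < αH) (hε0 : 0 ≤ ε)
    (hs : |s| ≤ M) (hi : |i| ≤ M) (hh : |h| ≤ M)
    (hp : p = max (-s) 0) (hq : q = max (-i) 0) (hr : r = max (-h) 0) :
    -2 * p * (Λ - β * i * s - β * ε * h * s + αI * i - μ * s + αH * h)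
    + -2 * q * (β * i * s + β * ε * h * s - (αI + γI + μ + δ) * i)
    + -2 * r * (δ * i - (γH + μ + αH) * h)
    ≤ (4 * β * M + 4 * (β * ε) * M + αI + αH + δ) * (p ^ 2 + q ^ 2 + r ^ 2) := by
  obtain ⟨p0, p1, p2, p3, p4⟩ := neg_part_facts s M hs
  obtain ⟨q0, q1, q2, q3, q4⟩ := neg_part_facts i M hi
  obtain ⟨r0, r1, r2, r3, r4⟩ := neg_part_facts h M hh
  rw [← hp] at p0 p1 p2 p3 p4
  rw [← hq] at q0 q1 q2 q3 q4
  rw [← hr] at r0 r1 r2 r3 r4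
  have hM : 0 ≤ M := (abs_nonneg s).trans hs
  have hs' := abs_le.mp hs
  have hi' := abs_le.mp hi
  have hh' := abs_le.mp hh
  have hb : 0 ≤ β * ε := by positivity
  have young : ∀ a b : ℝ, 2 * (a * b) ≤ a ^ 2 + b ^ 2 := fun a b => by
    nlinarith [sq_nonneg (a - b)]
  have e1 : -2 * p * (Λ - β * i * s - β * ε * h * s + αI * i - μ * s + αH * h)
      ≤ (2 * β * M + 2 * (β * ε) * M) * p ^ 2 + αI * (p ^ 2 + q ^ 2)
        + αH * (p ^ 2 + r ^ 2) := by
    have a1 : -2 * p * (Λ - β * i * s - β * ε * h * s + αI * i - μ * s + αH * h)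
      = -2 * (p * Λ) + 2 * β * (-i * p ^ 2) + 2 * (β * ε) * (-h * p ^ 2) - 2 * μ * p ^ 2
        + 2 * αI * (p * -i) + 2 * αH * (p * -h) := by
      linear_combination (2 * β * i + 2 * (β * ε) * h + 2 * μ) * p1
    have a2 : -i * p ^ 2 ≤ M * p ^ 2 := by gcongr; linarith
    have a3 : -h * p ^ 2 ≤ M * p ^ 2 := by gcongr; linarith
    have a4 : p * -i ≤ p * q := by gcongr
    have a5 : p * -h ≤ p * r := by gcongr
    have b2 := mul_le_mul_of_nonneg_left a2 (by positivity : 0 ≤ 2 * β)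
    have b3 := mul_le_mul_of_nonneg_left a3 (by positivity : 0 ≤ 2 * (β * ε))
    have b4 := mul_le_mul_of_nonneg_left (a4) (by positivity : 0 ≤ 2 * αI)
    have b5 := mul_le_mul_of_nonneg_left (a5) (by positivity : 0 ≤ 2 * αH)
    have c4 := mul_le_mul_of_nonneg_left (young p q) hαI.le
    have c5 := mul_le_mul_of_nonneg_left (young p r) hαH.le
    have d1 : 0 ≤ p * Λ := by positivity
    have d2 : 0 ≤ μ * p ^ 2 := by positivity
    linarith
  have e2 : -2 * q * (β * i * s + β * ε * h * s - (αI + γI + μ + δ) * i)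
      ≤ 2 * β * M * q ^ 2 + (β * ε) * M * (2 * q ^ 2 + p ^ 2 + r ^ 2) := by
    have a1 : -2 * q * (β * i * s + β * ε * h * s - (αI + γI + μ + δ) * i)
      = 2 * β * (s * q ^ 2) + 2 * (β * ε) * (q * (-(h * s)))
        - 2 * ((αI + γI + μ + δ) * q ^ 2) := by
      linear_combination (-2 * β * s + 2 * (αI + γI + μ + δ)) * q1
    have a2 : s * q ^ 2 ≤ M * q ^ 2 := by gcongr; linarith
    have a3 : -(h * s) ≤ M * (p + r) := by
      have u1 := mul_le_mul_of_nonneg_right r4 p0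
      have u2 := mul_le_mul_of_nonneg_right p4 r0
      have u3 : 0 ≤ (h + r) * (s + p) := mul_nonneg (by linarith) (by linarith)
      have u4 : 0 ≤ r * p := by positivity
      nlinarith
    have a4 : q * (-(h * s)) ≤ q * (M * (p + r)) := by gcongr
    have b2 := mul_le_mul_of_nonneg_left a2 (by positivity : 0 ≤ 2 * β)
    have b4 := mul_le_mul_of_nonneg_left a4 (by positivity : 0 ≤ 2 * (β * ε))
    have c1 := mul_le_mul_of_nonneg_left (young q p) (by positivity : 0 ≤ β * ε * M)
    have c2 := mul_le_mul_of_nonneg_left (young q r) (by positivity : 0 ≤ β * ε * M)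
    have d1 : 0 ≤ (αI + γI + μ + δ) * q ^ 2 := by positivity
    linarith
  have e3 : -2 * r * (δ * i - (γH + μ + αH) * h) ≤ δ * (q ^ 2 + r ^ 2) := by
    have a1 : -2 * r * (δ * i - (γH + μ + αH) * h)
      = 2 * δ * (r * -i) - 2 * ((γH + μ + αH) * r ^ 2) := by
      linear_combination 2 * (γH + μ + αH) * r1
    have a4 : r * -i ≤ r * q := by gcongr
    have b4 := mul_le_mul_of_nonneg_left a4 (by positivity : 0 ≤ 2 * δ)
    have c1 := mul_le_mul_of_nonneg_left (young r q) hδ.le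
    have d1 : 0 ≤ (γH + μ + αH) * r ^ 2 := by positivity
    linarith
  have f1 : 0 ≤ β * M * p ^ 2 := by positivity
  have f2 : 0 ≤ β * M * q ^ 2 := by positivity
  have f3 : 0 ≤ β * M * r ^ 2 := by positivity
  have f4 : 0 ≤ β * ε * M * p ^ 2 := by positivity
  have f5 : 0 ≤ β * ε * M * q ^ 2 := by positivity
  have f6 : 0 ≤ β * ε * M * r ^ 2 := by positivity
  have f7 : 0 ≤ αI * r ^ 2 := by positivity
  have f8 : 0 ≤ αH * q ^ 2 := by positivity
  have f9 : 0 ≤ δ * p ^ 2 := by positivity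
  linarith

/-- Positive invariance of the nonnegative orthant for the SISHD model. -/
theorem sishd_positivity
    (Λ μ β ε αI γI δ γH αH : ℝ)
    (hΛ : 0 < Λ) (hμ : 0 < μ) (hβ : 0 < β) (hαI : 0 < αI) (hγI : 0 < γI)
    (hδ : 0 < δ) (hγH : 0 < γH) (hαH : 0 < αH) (hε0 : 0 ≤ ε) (hε1 : ε ≤ 1)
    (S I H D : ℝ → ℝ)
    (hS : Differentiable ℝ S) (hI : Differentiable ℝ I)
    (hH : Differentiable ℝ H) (hD : Differentiable ℝ D)
    (hSode : ∀ t ≥ (0:ℝ), deriv S t =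
      Λ - β * I t * S t - β * ε * H t * S t + αI * I t - μ * S t + αH * H t)
    (hIode : ∀ t ≥ (0:ℝ), deriv I t =
      β * I t * S t + β * ε * H t * S t - (αI + γI + μ + δ) * I t)
    (hHode : ∀ t ≥ (0:ℝ), deriv H t = δ * I t - (γH + μ + αH) * H t)
    (hDode : ∀ t ≥ (0:ℝ), deriv D t = γI * I t + γH * H t)
    (hS0 : 0 ≤ S 0) (hI0 : 0 ≤ I 0) (hH0 : 0 ≤ H 0) (hD0 : 0 ≤ D 0) :
    ∀ t ≥ (0:ℝ), 0 ≤ S t ∧ 0 ≤ I t ∧ 0 ≤ H t ∧ 0 ≤ D t := by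
  have key : ∀ t ≥ (0:ℝ), 0 ≤ S t ∧ 0 ≤ I t ∧ 0 ≤ H t := by
    intro T hT
    have bdd : ∀ f : ℝ → ℝ, Differentiable ℝ f → ∃ C, ∀ t ∈ Set.Icc 0 T, |f t| ≤ C :=
      fun f hf => isCompact_Icc.exists_bound_of_continuousOn hf.continuous.continuousOn
    obtain ⟨M1, hM1⟩ := bdd S hS
    obtain ⟨M2, hM2⟩ := bdd I hI
    obtain ⟨M3, hM3⟩ := bdd H hH
    obtain ⟨M, hMa, hMb, hMc⟩ : ∃ M, M1 ≤ M ∧ M2 ≤ M ∧ M3 ≤ M :=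
      ⟨max M1 (max M2 M3), by simp, by simp, by simp⟩
    obtain ⟨K, hK⟩ : ∃ K, K = 4 * β * M + 4 * (β * ε) * M + αI + αH + δ := ⟨_, rfl⟩
    have hn : ∀ f : ℝ → ℝ, Differentiable ℝ f → ∀ t,
        HasDerivAt (fun t => (max (-f t) 0) ^ 2) (-2 * max (-f t) 0 * deriv f t) t :=
      fun f hf t => (neg_part_sq_hasDerivAt (f t)).comp t (hf t).hasDerivAt
    have hV := fun t => ((hn S hS t).add (hn I hI t)).add (hn H hH t)
    have hE : ∀ t, HasDerivAt (fun t : ℝ => Real.exp (-K * t)) (Real.exp (-K * t) * -K) t :=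
      fun t => by simpa using ((hasDerivAt_id t).const_mul (-K)).exp
    have hW := fun t => (hV t).mul (hE t)
    have anti := antitoneOn_of_deriv_nonpos (convex_Icc 0 T)
      (fun t _ => (hW t).continuousAt.continuousWithinAt)
      (fun t _ => (hW t).differentiableAt.differentiableWithinAt)
      (by
        intro t ht
        rw [interior_Icc] at ht
        have ht' := Set.Ioo_subset_Icc_self ht
        rw [(hW t).deriv]
        have en := sishd_energy Λ μ β ε αI γI δ γH αH M (S t) (I t) (H t) _ _ _
          hΛ hμ hβ hαI hγI hδ hγH hαH hε0 ((hM1 t ht').trans hMa) ((hM2 t ht').trans hMb)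
          ((hM3 t ht').trans hMc) rfl rfl rfl
        rw [← hK, ← hSode t ht'.1, ← hIode t ht'.1, ← hHode t ht'.1] at en
        have := mul_le_mul_of_nonneg_right en (Real.exp_pos (-K * t)).le
        simp only [Pi.add_apply]
        linarith)
    have h0 := anti (Set.left_mem_Icc.mpr hT) (Set.right_mem_Icc.mpr hT) hT
    simp only [Pi.add_apply, Pi.mul_apply] at h0
    rw [max_eq_right (by linarith : -S 0 ≤ 0), max_eq_right (by linarith : -I 0 ≤ 0),
      max_eq_right (by linarith : -H 0 ≤ 0)] at h0
    have h1 : (max (-S T) 0) ^ 2 + (max (-I T) 0) ^ 2 + (max (-H T) 0) ^ 2 ≤ 0 := by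
      refine le_of_mul_le_mul_right ?_ (Real.exp_pos (-K * T))
      linarith
    have z : ∀ x : ℝ, (max (-x) 0) ^ 2 ≤ 0 → 0 ≤ x := by
      intro x hx
      have h2 : max (-x) 0 = 0 := by
        have := sq_nonneg (max (-x) 0)
        exact pow_eq_zero_iff (two_ne_zero) |>.mp (le_antisymm hx this)
      have := le_max_left (-x) 0
      linarith
    have n1 := sq_nonneg (max (-S T) 0)
    have n2 := sq_nonneg (max (-I T) 0)
    have n3 := sq_nonneg (max (-H T) 0)
    exact ⟨z _ (by linarith), z _ (by linarith), z _ (by linarith)⟩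
  intro t ht
  obtain ⟨k1, k2, k3⟩ := key t ht
  refine ⟨k1, k2, k3, ?_⟩
  have mono : MonotoneOn D (Set.Ici 0) := by
    apply monotoneOn_of_deriv_nonneg (convex_Ici 0) hD.continuous.continuousOn
      hD.differentiableOn
    intro x hx
    rw [interior_Ici] at hx
    have hx' : (0:ℝ) ≤ x := le_of_lt hx
    obtain ⟨_, j2, j3⟩ := key x hx'
    rw [hDode x hx']
    positivity
  exact hD0.trans (mono Set.self_mem_Ici ht ht)
end

section
/- Suppose S, I, H : ℝ → ℝ are differentiable, nonnegative on [0,∞), and satisfy for all t ≥ 0 the SISHD equations S'(t) = Λ - βI(t)S(t) - βεH(t)S(t) + αI·I(t) - μS(t) + αH·H(t), I'(t) = βI(t)S(t) + βεH(t)S(t) - (αI+γI+μ+δ)I(t), H'(t) = δI(t) - (γH+μ+αH)H(t). Let N(t) = S(t) + I(t) + H(t). Then for all t ≥ 0, N(t) ≤ (N(0) - Λ/μ)·e^(−μt) + Λ/μ. -/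
/-- Comparison bound for the total living population of the SISHD model. -/
theorem sishd_population_bound
    (Λ μ β ε αI γI δ γH αH : ℝ)
    (hΛ : 0 < Λ) (hμ : 0 < μ) (hβ : 0 < β) (hαI : 0 < αI) (hγI : 0 < γI)
    (hδ : 0 < δ) (hγH : 0 < γH) (hαH : 0 < αH) (hε0 : 0 ≤ ε) (hε1 : ε ≤ 1)
    (S I H : ℝ → ℝ)
    (hS : Differentiable ℝ S) (hI : Differentiable ℝ I) (hH : Differentiable ℝ H)
    (hSpos : ∀ t ≥ (0:ℝ), 0 ≤ S t) (hIpos : ∀ t ≥ (0:ℝ), 0 ≤ I t)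
    (hHpos : ∀ t ≥ (0:ℝ), 0 ≤ H t)
    (hSode : ∀ t ≥ (0:ℝ), deriv S t =
      Λ - β * I t * S t - β * ε * H t * S t + αI * I t - μ * S t + αH * H t)
    (hIode : ∀ t ≥ (0:ℝ), deriv I t =
      β * I t * S t + β * ε * H t * S t - (αI + γI + μ + δ) * I t)
    (hHode : ∀ t ≥ (0:ℝ), deriv H t = δ * I t - (γH + μ + αH) * H t)
    (N : ℝ → ℝ) (hN : ∀ t, N t = S t + I t + H t) :
    ∀ t ≥ (0:ℝ), N t ≤ (N 0 - Λ / μ) * Real.exp (-μ * t) + Λ / μ := by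
  have hder : ∀ t, HasDerivAt (fun t => (S t + I t + H t - Λ / μ) * Real.exp (μ * t))
      ((deriv S t + deriv I t + deriv H t) * Real.exp (μ * t)
        + (S t + I t + H t - Λ / μ) * (Real.exp (μ * t) * μ)) t := by
    intro t
    have h1 : HasDerivAt (fun t => S t + I t + H t - Λ / μ)
        (deriv S t + deriv I t + deriv H t) t :=
      (((hS t).hasDerivAt.add (hI t).hasDerivAt).add (hH t).hasDerivAt).sub_const _
    have h2 : HasDerivAt (fun t => Real.exp (μ * t)) (Real.exp (μ * t) * μ) t := by
      have h3 := ((hasDerivAt_id t).const_mul μ).exp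
      simpa using h3
    exact h1.mul h2
  have hanti : AntitoneOn (fun t => (S t + I t + H t - Λ / μ) * Real.exp (μ * t))
      (Set.Ici (0:ℝ)) := by
    apply antitoneOn_of_deriv_nonpos (convex_Ici 0)
    · exact fun t _ => (hder t).continuousAt.continuousWithinAt
    · exact fun t _ => (hder t).differentiableAt.differentiableWithinAt
    · intro t ht
      have ht0 : t ≥ 0 := interior_subset ht
      rw [(hder t).deriv, hSode t ht0, hIode t ht0, hHode t ht0]
      have hc : Λ / μ * μ = Λ := div_mul_cancel₀ _ hμ.ne'
      have hA : 0 ≤ (γI * I t + γH * H t) * Real.exp (μ * t) :=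
        mul_nonneg (add_nonneg (mul_nonneg hγI.le (hIpos t ht0))
          (mul_nonneg hγH.le (hHpos t ht0))) (Real.exp_pos _).le
      linear_combination hA - Real.exp (μ * t) * hc
  intro t ht
  have h := hanti (Set.mem_Ici.2 le_rfl) (Set.mem_Ici.2 ht) ht
  simp only [mul_zero, Real.exp_zero, mul_one, ← hN] at h
  have h4 := mul_le_mul_of_nonneg_right h (Real.exp_pos (-μ * t)).le
  have h5 : Real.exp (μ * t) * Real.exp (-μ * t) = 1 := by
    rw [← Real.exp_add]; simp
  rw [mul_assoc, h5] at h4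
  linarith
end

section
/- Suppose S, I, H : ℝ → ℝ are differentiable, nonnegative on [0,∞), and satisfy the SISHD equations S'(t) = Λ - βI(t)S(t) - βεH(t)S(t) + αI·I(t) - μS(t) + αH·H(t), I'(t) = βI(t)S(t) + βεH(t)S(t) - (αI+γI+μ+δ)I(t), H'(t) = δI(t) - (γH+μ+αH)H(t) for all t ≥ 0. Then limsup_{t→∞} (S(t) + I(t) + H(t)) ≤ Λ/μ. -/
/-- The total living population of the SISHD model satisfies
`limsup_{t → ∞} (S + I + H)(t) ≤ Λ/μ`. -/
theorem sishd_population_limsup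
    (Λ μ β ε αI γI δ γH αH : ℝ)
    (hΛ : 0 < Λ) (hμ : 0 < μ) (hβ : 0 < β) (hαI : 0 < αI) (hγI : 0 < γI)
    (hδ : 0 < δ) (hγH : 0 < γH) (hαH : 0 < αH) (hε0 : 0 ≤ ε) (hε1 : ε ≤ 1)
    (S I H : ℝ → ℝ)
    (hS : Differentiable ℝ S) (hI : Differentiable ℝ I) (hH : Differentiable ℝ H)
    (hSpos : ∀ t ≥ (0:ℝ), 0 ≤ S t) (hIpos : ∀ t ≥ (0:ℝ), 0 ≤ I t)
    (hHpos : ∀ t ≥ (0:ℝ), 0 ≤ H t)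
    (hSode : ∀ t ≥ (0:ℝ), deriv S t =
      Λ - β * I t * S t - β * ε * H t * S t + αI * I t - μ * S t + αH * H t)
    (hIode : ∀ t ≥ (0:ℝ), deriv I t =
      β * I t * S t + β * ε * H t * S t - (αI + γI + μ + δ) * I t)
    (hHode : ∀ t ≥ (0:ℝ), deriv H t = δ * I t - (γH + μ + αH) * H t) :
    Filter.limsup (fun t => S t + I t + H t) Filter.atTop ≤ Λ / μ := by
  have hd : ∀ t, HasDerivAt (fun t => (S t + I t + H t - Λ / μ) * Real.exp (μ * t))
      ((deriv S t + deriv I t + deriv H t) * Real.exp (μ * t)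
        + (S t + I t + H t - Λ / μ) * (Real.exp (μ * t) * μ)) t := by
    intro t
    have h1 := (((hS t).hasDerivAt.add (hI t).hasDerivAt).add (hH t).hasDerivAt).sub_const (Λ / μ)
    have h2 : HasDerivAt (fun t : ℝ => Real.exp (μ * t)) (Real.exp (μ * t) * μ) t := by
      have h3 : HasDerivAt (fun t : ℝ => μ * t) μ t := by
        simpa using (hasDerivAt_id t).const_mul μ
      exact h3.exp
    exact h1.mul h2
  have hanti : AntitoneOn (fun t => (S t + I t + H t - Λ / μ) * Real.exp (μ * t))
      (Set.Ici 0) := by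
    apply antitoneOn_of_deriv_nonpos (convex_Ici 0)
    · exact fun t _ => (hd t).continuousAt.continuousWithinAt
    · exact fun t _ => (hd t).differentiableAt.differentiableWithinAt
    · intro t ht
      rw [interior_Ici] at ht
      have ht0 : t ≥ 0 := le_of_lt ht
      rw [(hd t).deriv, hSode t ht0, hIode t ht0, hHode t ht0]
      have e : Λ / μ * μ = Λ := div_mul_cancel₀ _ hμ.ne'
      have key : ∀ E : ℝ, (Λ - β * I t * S t - β * ε * H t * S t + αI * I t - μ * S t + αH * H t
          + (β * I t * S t + β * ε * H t * S t - (αI + γI + μ + δ) * I t)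
          + (δ * I t - (γH + μ + αH) * H t)) * E + (S t + I t + H t - Λ / μ) * (E * μ)
          = -((γI * I t + γH * H t) * E) := by
        intro E
        linear_combination (-E) * e
      rw [key]
      have := hIpos t ht0
      have := hHpos t ht0
      have : 0 ≤ (γI * I t + γH * H t) * Real.exp (μ * t) := by positivity
      linarith
  have hbound : ∀ t ≥ (0:ℝ), S t + I t + H t
      ≤ Λ / μ + (S 0 + I 0 + H 0 - Λ / μ) * Real.exp (-(μ * t)) := by
    intro t ht
    have h := hanti (Set.mem_Ici.2 le_rfl) (Set.mem_Ici.2 ht) ht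
    simp only [mul_zero, Real.exp_zero, mul_one] at h
    have h4 := mul_le_mul_of_nonneg_right h (Real.exp_pos (-(μ * t))).le
    rw [mul_assoc, ← Real.exp_add, add_neg_cancel, Real.exp_zero, mul_one] at h4
    linarith
  have hlim : Filter.Tendsto
      (fun t => Λ / μ + (S 0 + I 0 + H 0 - Λ / μ) * Real.exp (-(μ * t)))
      Filter.atTop (nhds (Λ / μ)) := by
    have h5 : Filter.Tendsto (fun t : ℝ => Real.exp (-(μ * t))) Filter.atTop (nhds 0) :=
      Real.tendsto_exp_neg_atTop_nhds_zero.comp (Filter.tendsto_id.const_mul_atTop hμ)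
    simpa using (h5.const_mul (S 0 + I 0 + H 0 - Λ / μ)).const_add (Λ / μ)
  rw [← hlim.limsup_eq]
  refine Filter.limsup_le_limsup ?_ ?_ hlim.isBoundedUnder_le
  · filter_upwards [Filter.eventually_ge_atTop 0] with t ht using hbound t ht
  · apply Filter.IsBoundedUnder.isCoboundedUnder_le
    refine ⟨0, ?_⟩
    rw [Filter.eventually_map]
    filter_upwards [Filter.eventually_ge_atTop 0] with t ht
    have := hSpos t ht
    have := hIpos t ht
    have := hHpos t ht
    show 0 ≤ S t + I t + H t
    positivity
end

section
/- Let R₀ = βΛ[(γH+μ+αH) + εδ] / (μ(αI+γI+μ+δ)(γH+μ+αH)) and define S* = (αI+γI+μ+δ)(γH+μ+αH) / (β[(γH+μ+αH) + εδ]), I* = (γH+μ+αH)(Λ - μS*) / ((γI+μ+δ)(γH+μ+αH) - αH·δ), H* = δI*/(γH+μ+αH). If R₀ > 1, then (S*, I*, H*) satisfies the three equilibrium equations 0 = Λ - βI*S* - βεH*S* + αI·I* - μS* + αH·H*, 0 = βI*S* + βεH*S* - (αI+γI+μ+δ)I*, 0 = δI* - (γH+μ+αH)H*, and moreover S* > 0,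 I* > 0, H* > 0. -/
/-- If `R₀ > 1`, the point `(S*, I*, H*)` is an equilibrium of the reduced SISHD
system with all components positive. -/
theorem sishd_dee_exists
    (Λ μ β ε αI γI δ γH αH : ℝ)
    (hΛ : 0 < Λ) (hμ : 0 < μ) (hβ : 0 < β) (hαI : 0 < αI) (hγI : 0 < γI)
    (hδ : 0 < δ) (hγH : 0 < γH) (hαH : 0 < αH) (hε0 : 0 ≤ ε) (hε1 : ε ≤ 1)
    (R₀ Sstar Istar Hstar : ℝ)
    (hR₀ : R₀ = β * Λ * ((γH + μ + αH) + ε * δ) /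
      (μ * (αI + γI + μ + δ) * (γH + μ + αH)))
    (hSstar : Sstar = (αI + γI + μ + δ) * (γH + μ + αH) /
      (β * ((γH + μ + αH) + ε * δ)))
    (hIstar : Istar = (γH + μ + αH) * (Λ - μ * Sstar) /
      ((γI + μ + δ) * (γH + μ + αH) - αH * δ))
    (hHstar : Hstar = δ * Istar / (γH + μ + αH))
    (hR₀gt : 1 < R₀) :
    (0 = Λ - β * Istar * Sstar - β * ε * Hstar * Sstar + αI * Istar
        - μ * Sstar + αH * Hstar) ∧
    (0 = β * Istar * Sstar + β * ε * Hstar * Sstar - (αI + γI + μ + δ) * Istar) ∧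
    (0 = δ * Istar - (γH + μ + αH) * Hstar) ∧
    0 < Sstar ∧ 0 < Istar ∧ 0 < Hstar := by
  have hk : 0 < γH + μ + αH := by positivity
  have hq : 0 < β * ((γH + μ + αH) + ε * δ) := by positivity
  have ha : 0 < αI + γI + μ + δ := by positivity
  have hD : 0 < (γI + μ + δ) * (γH + μ + αH) - αH * δ := by
    have : (γI + μ + δ) * (γH + μ + αH) - αH * δ
        = (γI + μ) * (γH + μ + αH) + δ * (γH + μ) := by ring
    rw [this]; positivity
  have hS : 0 < Sstar := by rw [hSstar]; positivity
  have e1 : Sstar * (β * ((γH + μ + αH) + ε * δ))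
      = (αI + γI + μ + δ) * (γH + μ + αH) := by
    rw [hSstar]; exact div_mul_cancel₀ _ hq.ne'
  have e2 : Istar * ((γI + μ + δ) * (γH + μ + αH) - αH * δ)
      = (γH + μ + αH) * (Λ - μ * Sstar) := by
    rw [hIstar]; exact div_mul_cancel₀ _ hD.ne'
  have e3 : Hstar * (γH + μ + αH) = δ * Istar := by
    rw [hHstar]; exact div_mul_cancel₀ _ hk.ne'
  have hL : 0 < Λ - μ * Sstar := by
    rw [hR₀, one_lt_div (by positivity)] at hR₀gt
    have h : 0 < (Λ - μ * Sstar) * (β * ((γH + μ + αH) + ε * δ)) := by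
      have : (Λ - μ * Sstar) * (β * ((γH + μ + αH) + ε * δ))
          = β * Λ * ((γH + μ + αH) + ε * δ)
            - μ * (αI + γI + μ + δ) * (γH + μ + αH) := by
        linear_combination (-μ) * e1
      rw [this]; linarith
    exact pos_of_mul_pos_left h hq.le
  have hI : 0 < Istar := by rw [hIstar]; positivity
  have hH : 0 < Hstar := by rw [hHstar]; positivity
  have q2 : 0 = β * Istar * Sstar + β * ε * Hstar * Sstar
      - (αI + γI + μ + δ) * Istar := by
    apply mul_right_cancel₀ hk.ne'
    linear_combination (-Istar) * e1 - β * ε * Sstar * e3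
  have q1 : 0 = Λ - μ * Sstar - (γI + μ + δ) * Istar + αH * Hstar := by
    apply mul_right_cancel₀ hk.ne'
    linear_combination e2 - αH * e3
  refine ⟨?_, q2, ?_, hS, hI, hH⟩
  · linear_combination q1 - q2
  · linear_combination e3
end

section
/- Let R₀ = βΛ[(γH+μ+αH) + εδ] / (μ(αI+γI+μ+δ)(γH+μ+αH)) and define S* = (αI+γI+μ+δ)(γH+μ+αH) / (β[(γH+μ+αH) + εδ]), I* = (γH+μ+αH)(Λ - μS*) / ((γI+μ+δ)(γH+μ+αH) - αH·δ), H* = δI*/(γH+μ+αH). If (S, I, H) ∈ ℝ³ satisfies the equilibrium equations 0 = Λ - βIS - βεHS + αI·I - μS + αH·H, 0 = βIS + βεHS - (αI+γI+μ+δ)I, 0 = δI - (γH+μ+αH)H with I ≠ 0, then (S, I, H) = (S*, I*, H*); i.e., the disease-endemic equilibrium is unique. -/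
/-- Any equilibrium of the reduced SISHD system with `I ≠ 0` coincides with the
disease-endemic equilibrium `(S*, I*, H*)`. -/
theorem sishd_dee_unique
    (Λ μ β ε αI γI δ γH αH : ℝ)
    (hΛ : 0 < Λ) (hμ : 0 < μ) (hβ : 0 < β) (hαI : 0 < αI) (hγI : 0 < γI)
    (hδ : 0 < δ) (hγH : 0 < γH) (hαH : 0 < αH) (hε0 : 0 ≤ ε) (hε1 : ε ≤ 1)
    (R₀ Sstar Istar Hstar : ℝ)
    (hR₀ : R₀ = β * Λ * ((γH + μ + αH) + ε * δ) /
      (μ * (αI + γI + μ + δ) * (γH + μ + αH)))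
    (hSstar : Sstar = (αI + γI + μ + δ) * (γH + μ + αH) /
      (β * ((γH + μ + αH) + ε * δ)))
    (hIstar : Istar = (γH + μ + αH) * (Λ - μ * Sstar) /
      ((γI + μ + δ) * (γH + μ + αH) - αH * δ))
    (hHstar : Hstar = δ * Istar / (γH + μ + αH))
    (S I H : ℝ)
    (heq1 : 0 = Λ - β * I * S - β * ε * H * S + αI * I - μ * S + αH * H)
    (heq2 : 0 = β * I * S + β * ε * H * S - (αI + γI + μ + δ) * I)
    (heq3 : 0 = δ * I - (γH + μ + αH) * H)
    (hI : I ≠ 0) :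
    S = Sstar ∧ I = Istar ∧ H = Hstar := by
  have hk : 0 < γH + μ + αH := by positivity
  have hc : 0 < β * ((γH + μ + αH) + ε * δ) := by positivity
  have hd : 0 < (γI + μ + δ) * (γH + μ + αH) - αH * δ := by
    have : (γI + μ + δ) * (γH + μ + αH) - αH * δ
        = (γI + μ) * (γH + μ + αH) + δ * (γH + μ) := by ring
    rw [this]; positivity
  have hS : S = Sstar := by
    rw [hSstar, eq_div_iff hc.ne']
    apply mul_left_cancel₀ hI
    linear_combination (-(γH + μ + αH)) * heq2 - β * ε * S * heq3
  have hII : I = Istar := by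
    rw [hIstar, ← hS, eq_div_iff hd.ne']
    linear_combination (γH + μ + αH) * (heq1 + heq2) + αH * heq3
  refine ⟨hS, hII, ?_⟩
  rw [hHstar, ← hII, eq_div_iff hk.ne']
  linear_combination heq3
end

section
/- Let R₀ = βΛ[(γH+μ+αH) + εδ] / (μ(αI+γI+μ+δ)(γH+μ+αH)) and S* = (αI+γI+μ+δ)(γH+μ+αH) / (β[(γH+μ+αH) + εδ]). Then μS* < Λ if and only if R₀ > 1. Consequently, with I* = (γH+μ+αH)(Λ - μS*) / ((γI+μ+δ)(γH+μ+αH) - αH·δ), one has I* > 0 if and only if R₀ > 1. -/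
/-- `μ S* < Λ` iff `R₀ > 1`, and consequently `I* > 0` iff `R₀ > 1`. -/
theorem sishd_Istar_pos_iff
    (Λ μ β ε αI γI δ γH αH : ℝ)
    (hΛ : 0 < Λ) (hμ : 0 < μ) (hβ : 0 < β) (hαI : 0 < αI) (hγI : 0 < γI)
    (hδ : 0 < δ) (hγH : 0 < γH) (hαH : 0 < αH) (hε0 : 0 ≤ ε) (hε1 : ε ≤ 1)
    (R₀ Sstar Istar : ℝ)
    (hR₀ : R₀ = β * Λ * ((γH + μ + αH) + ε * δ) /
      (μ * (αI + γI + μ + δ) * (γH + μ + αH)))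
    (hSstar : Sstar = (αI + γI + μ + δ) * (γH + μ + αH) /
      (β * ((γH + μ + αH) + ε * δ)))
    (hIstar : Istar = (γH + μ + αH) * (Λ - μ * Sstar) /
      ((γI + μ + δ) * (γH + μ + αH) - αH * δ)) :
    (μ * Sstar < Λ ↔ 1 < R₀) ∧ (0 < Istar ↔ 1 < R₀) := by
  have hH : 0 < γH + μ + αH := by positivity
  have hB : 0 < β * ((γH + μ + αH) + ε * δ) := by positivity
  have hM : 0 < μ * (αI + γI + μ + δ) * (γH + μ + αH) := by positivity
  have hD : 0 < (γI + μ + δ) * (γH + μ + αH) - αH * δ := by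
    have h : (γI + μ + δ) * (γH + μ + αH) - αH * δ
        = (γI + μ) * (γH + μ + αH) + δ * (γH + μ) := by ring
    rw [h]; positivity
  have h1 : μ * Sstar < Λ ↔ 1 < R₀ := by
    rw [hSstar, hR₀, ← mul_div_assoc, div_lt_iff₀ hB, one_lt_div hM]
    constructor <;> intro h <;> linarith
  refine ⟨h1, ?_⟩
  rw [← h1, hIstar, div_pos_iff_of_pos_right hD, mul_pos_iff_of_pos_left hH, sub_pos]
end

section
/- Let F and V be the 2×2 real matrices F = [[βΛ/μ, βεΛ/μ], [0, 0]] and V = [[αI+γI+μ+δ, 0], [−δ, γH+μ+αH]], arising from the next-generation decomposition of the SISHD model at the disease-free equilibrium. Then V is invertible and the characteristic polynomial of F·V⁻¹ equals X·(X − R₀), where R₀ = βΛ[(γH+μ+αH) + εδ] / (μ(αI+γI+μ+δ)(γH+μ+αH)); in particular, the spectral radius of F·V⁻¹ equals R₀. -/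
open Polynomial

/-- Next-generation matrix of the SISHD model: `V` is invertible, the
characteristic polynomial of `F ⬝ V⁻¹` is `X (X - R₀)`, and the spectral
radius of `F ⬝ V⁻¹` equals `R₀`. -/
theorem sishd_next_generation
    (Λ μ β ε αI γI δ γH αH : ℝ)
    (hΛ : 0 < Λ) (hμ : 0 < μ) (hβ : 0 < β) (hαI : 0 < αI) (hγI : 0 < γI)
    (hδ : 0 < δ) (hγH : 0 < γH) (hαH : 0 < αH) (hε0 : 0 ≤ ε) (hε1 : ε ≤ 1)
    (R₀ : ℝ)
    (hR₀ : R₀ = β * Λ * ((γH + μ + αH) + ε * δ) /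
      (μ * (αI + γI + μ + δ) * (γH + μ + αH)))
    (F V : Matrix (Fin 2) (Fin 2) ℝ)
    (hF : F = !![β * Λ / μ, β * ε * Λ / μ; 0, 0])
    (hV : V = !![αI + γI + μ + δ, 0; -δ, γH + μ + αH]) :
    IsUnit V ∧
    (F * V⁻¹).charpoly = X * (X - C R₀) ∧
    spectralRadius ℝ (F * V⁻¹) = ENNReal.ofReal R₀ := by
  have ha : 0 < αI + γI + μ + δ := by positivity
  have hb : 0 < γH + μ + αH := by positivity
  have hdet : V.det = (αI + γI + μ + δ) * (γH + μ + αH) := by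
    rw [hV, Matrix.det_fin_two_of]; ring
  have hdet0 : IsUnit V.det := by
    rw [hdet]; exact (mul_pos ha hb).ne'.isUnit
  have hR : 0 ≤ R₀ := by rw [hR₀]; positivity
  have hinv : V⁻¹ = !![1 / (αI + γI + μ + δ), 0;
      δ / ((αI + γI + μ + δ) * (γH + μ + αH)), 1 / (γH + μ + αH)] := by
    apply Matrix.inv_eq_right_inv
    rw [hV, Matrix.mul_fin_two, Matrix.one_fin_two]
    congr! 4
    all_goals field_simp
    all_goals ring
  have hprod : F * V⁻¹ = !![R₀, β * ε * Λ / μ / (γH + μ + αH); 0, 0] := by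
    rw [hinv, hF, Matrix.mul_fin_two, hR₀]
    generalize αI + γI + μ + δ = a at *
    generalize γH + μ + αH = b at *
    ext i j
    fin_cases i <;> fin_cases j <;> simp <;> field_simp
  have hchar : (F * V⁻¹).charpoly = X * (X - C R₀) := by
    rw [hprod, Matrix.charpoly_fin_two]
    simp [Matrix.trace_fin_two, Matrix.det_fin_two]
    ring
  refine ⟨(Matrix.isUnit_iff_isUnit_det V).2 hdet0, hchar, ?_⟩
  have hmem : ∀ k : ℝ, k ∈ spectrum ℝ (F * V⁻¹) ↔ k = 0 ∨ k = R₀ := by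
    intro k
    rw [Matrix.mem_spectrum_iff_isRoot_charpoly, hchar]
    simp [sub_eq_zero]
  have hn : (ENNReal.ofReal R₀) = ‖R₀‖₊ := by
    rw [← Real.enorm_of_nonneg hR]; rfl
  rw [hn]
  unfold spectralRadius
  apply le_antisymm
  · refine iSup₂_le fun k hk => ?_
    rcases (hmem k).1 hk with rfl | rfl
    · simp
    · exact le_rfl
  · exact le_iSup₂ (f := fun (k : ℝ) (_ : k ∈ spectrum ℝ (F * V⁻¹)) => (‖k‖₊ : ENNReal))
      R₀ ((hmem R₀).2 (Or.inr rfl))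
end

section
/- Let J₀ be the 3×3 Jacobian matrix of the reduced SISHD system evaluated at the disease-free equilibrium (Λ/μ, 0, 0), namely J₀ = [[−μ, −βΛ/μ + αI, −βεΛ/μ + αH], [0, βΛ/μ − (αI+γI+μ+δ), βεΛ/μ], [0, δ, −(γH+μ+αH)]]. If R₀ = βΛ[(γH+μ+αH) + εδ] / (μ(αI+γI+μ+δ)(γH+μ+αH)) < 1, then every complex root of the characteristic polynomial of J₀ has negative real part. -/
lemma quad_re_neg (p q : ℝ) (hp : 0 < p) (hq : 0 < q) (z : ℂ)
    (h : z ^ 2 + (p : ℂ) * z + (q : ℂ) = 0) : z.re < 0 := by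
  by_contra! hx
  have h1 := congrArg Complex.re h
  have h2 := congrArg Complex.im h
  simp [pow_two] at h1 h2
  have h3 : z.im * (2 * z.re + p) = 0 := by linarith
  rcases mul_eq_zero.mp h3 with h4 | h4
  · rw [h4] at h1
    nlinarith [mul_nonneg hx hx, mul_nonneg hp.le hx]
  · linarith

lemma charpoly_form (m a b c d e f : ℝ) :
    (!![-m, a, b; 0, c, d; 0, e, f] : Matrix (Fin 3) (Fin 3) ℝ).charpoly =
      (Polynomial.X + Polynomial.C m) * (Polynomial.X ^ 2 +
        Polynomial.C (-c - f) * Polynomial.X + Polynomial.C (c * f - d * e)) := by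
  simp [Matrix.charpoly, Matrix.det_fin_three, Matrix.charmatrix_apply]
  ring

/-- If `R₀ < 1`, every complex root of the characteristic polynomial of the
Jacobian at the disease-free equilibrium has negative real part. -/
theorem sishd_dfe_locally_stable
    (Λ μ β ε αI γI δ γH αH : ℝ)
    (hΛ : 0 < Λ) (hμ : 0 < μ) (hβ : 0 < β) (hαI : 0 < αI) (hγI : 0 < γI)
    (hδ : 0 < δ) (hγH : 0 < γH) (hαH : 0 < αH) (hε0 : 0 ≤ ε) (hε1 : ε ≤ 1)
    (R₀ : ℝ)
    (hR₀ : R₀ = β * Λ * ((γH + μ + αH) + ε * δ) /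
      (μ * (αI + γI + μ + δ) * (γH + μ + αH)))
    (J₀ : Matrix (Fin 3) (Fin 3) ℝ)
    (hJ₀ : J₀ = !![-μ, -(β * Λ / μ) + αI, -(β * ε * Λ / μ) + αH;
                   0, β * Λ / μ - (αI + γI + μ + δ), β * ε * Λ / μ;
                   0, δ, -(γH + μ + αH)])
    (hR₀lt : R₀ < 1) :
    ∀ z : ℂ, Polynomial.aeval z J₀.charpoly = 0 → z.re < 0 := by
  intro z hz
  rw [hJ₀, charpoly_form] at hz
  rw [map_mul, mul_eq_zero] at hz
  rcases hz with hz | hz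
  · have h1 := congrArg Complex.re hz
    simp at h1
    linarith
  · have hb : 0 < β * Λ / μ := by positivity
    have he : β * ε * Λ / μ = ε * (β * Λ / μ) := by ring
    have ha : 0 < αI + γI + μ + δ := by positivity
    have hh : 0 < γH + μ + αH := by positivity
    have key : (β * Λ / μ) * ((γH + μ + αH) + ε * δ) <
        (αI + γI + μ + δ) * (γH + μ + αH) := by
      rw [hR₀, div_lt_one (by positivity)] at hR₀lt
      rw [div_mul_eq_mul_div, div_lt_iff₀ hμ]
      linarith
    rw [he] at hz
    generalize β * Λ / μ = b at *
    generalize αI + γI + μ + δ = a at *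
    generalize γH + μ + αH = h at *
    have hnn : 0 ≤ b * (ε * δ) := by positivity
    have hab : b < a := by
      by_contra! hc
      nlinarith [mul_le_mul_of_nonneg_right hc hh.le]
    refine quad_re_neg (-(b - a) - -h) ((b - a) * -h - ε * b * δ) (by linarith)
      (by linarith) z ?_
    simpa using hz
end

section
/- Let J₀ be the 3×3 Jacobian matrix of the reduced SISHD system evaluated at the disease-free equilibrium (Λ/μ, 0, 0), namely J₀ = [[−μ, −βΛ/μ + αI, −βεΛ/μ + αH], [0, βΛ/μ − (αI+γI+μ+δ), βεΛ/μ], [0, δ, −(γH+μ+αH)]]. If R₀ = βΛ[(γH+μ+αH) + εδ] / (μ(αI+γI+μ+δ)(γH+μ+αH)) > 1, then the characteristic polynomial of J₀ has a complex root with positive real part; in particular the disease-free equilibrium is unstable. -/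
/-- If `R₀ > 1`, the characteristic polynomial of the Jacobian at the
disease-free equilibrium has a complex root with positive real part, so the
disease-free equilibrium is unstable. -/
theorem sishd_dfe_unstable
    (Λ μ β ε αI γI δ γH αH : ℝ)
    (hΛ : 0 < Λ) (hμ : 0 < μ) (hβ : 0 < β) (hαI : 0 < αI) (hγI : 0 < γI)
    (hδ : 0 < δ) (hγH : 0 < γH) (hαH : 0 < αH) (hε0 : 0 ≤ ε) (hε1 : ε ≤ 1)
    (R₀ : ℝ)
    (hR₀ : R₀ = β * Λ * ((γH + μ + αH) + ε * δ) /
      (μ * (αI + γI + μ + δ) * (γH + μ + αH)))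
    (J₀ : Matrix (Fin 3) (Fin 3) ℝ)
    (hJ₀ : J₀ = !![-μ, -(β * Λ / μ) + αI, -(β * ε * Λ / μ) + αH;
                   0, β * Λ / μ - (αI + γI + μ + δ), β * ε * Λ / μ;
                   0, δ, -(γH + μ + αH)])
    (hR₀gt : 1 < R₀) :
    ∃ z : ℂ, Polynomial.aeval z J₀.charpoly = 0 ∧ 0 < z.re := by
  obtain ⟨s, hs⟩ : ∃ s, s = β * Λ / μ := ⟨_, rfl⟩
  obtain ⟨c, hc⟩ : ∃ c, c = αI + γI + μ + δ := ⟨_, rfl⟩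
  obtain ⟨d, hd⟩ : ∃ d, d = γH + μ + αH := ⟨_, rfl⟩
  have hcpos : 0 < c := by rw [hc]; positivity
  have hdpos : 0 < d := by rw [hd]; positivity
  have hes : β * ε * Λ / μ = ε * s := by rw [hs]; ring
  rw [hes, ← hs, ← hc, ← hd] at hJ₀
  have hkey : 0 < (s - c) * d + ε * s * δ := by
    have h1 : R₀ = s * (d + ε * δ) / (c * d) := by
      rw [hR₀, hs, ← hc, ← hd]
      field_simp
    rw [h1, lt_div_iff₀ (by positivity)] at hR₀gt
    nlinarith
  have hD : (d - (s - c)) ^ 2 < (s - c + d) ^ 2 + 4 * (ε * s * δ) := by nlinarith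
  obtain ⟨r, hr⟩ : ∃ r, r = √((s - c + d) ^ 2 + 4 * (ε * s * δ)) := ⟨_, rfl⟩
  have hr2 : r ^ 2 = (s - c + d) ^ 2 + 4 * (ε * s * δ) := by
    rw [hr]; exact Real.sq_sqrt ((sq_nonneg _).trans hD.le)
  have hrpos : d - (s - c) < r := by
    rw [hr]; exact Real.lt_sqrt_of_sq_lt hD
  have hroot : J₀.charpoly.eval ((s - c - d + r) / 2) = 0 := by
    rw [Matrix.eval_charpoly, hJ₀, Matrix.det_fin_three]
    simp
    linear_combination ((s - c - d + r) / 2 + μ) / 4 * hr2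
  refine ⟨(((s - c - d + r) / 2 : ℝ) : ℂ), ?_, ?_⟩
  · have h := Polynomial.aeval_algebraMap_apply ℂ ((s - c - d + r) / 2) J₀.charpoly
    rw [Polynomial.coe_aeval_eq_eval, hroot, map_zero] at h
    exact h
  · rw [Complex.ofReal_re]; linarith
end

section
/- Assume R₀ = βΛ[(γH+μ+αH) + εδ] / (μ(αI+γI+μ+δ)(γH+μ+αH)) > 1. Let (S*, I*, H*) be the disease-endemic equilibrium given by S* = (αI+γI+μ+δ)(γH+μ+αH) / (β[(γH+μ+αH) + εδ]), I* = (γH+μ+αH)(Λ − μS*) / ((γI+μ+δ)(γH+μ+αH) − αH·δ), H* = δI*/(γH+μ+αH), and let λ³ + a₁λ² + a₂λ + a₃ be the characteristic polynomial of the Jacobian matrix J(S*, I*, H*) = [[−βI* − βεH* − μ, −βS* + αI, −βεS* + αH], [βI* + βεH*, βS* − (αI+γI+μ+δ), βεS*], [0, δ, −(γH+μ+αH)]]. Then a₁ > 0, a₃ > 0 and a₁a₂ − a₃ > 0. -/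
open Polynomial

/-- The Routh–Hurwitz quantities of the characteristic polynomial of the
Jacobian at the disease-endemic equilibrium are positive when `R₀ > 1`. -/
theorem sishd_routh_hurwitz
    (Λ μ β ε αI γI δ γH αH : ℝ)
    (hΛ : 0 < Λ) (hμ : 0 < μ) (hβ : 0 < β) (hαI : 0 < αI) (hγI : 0 < γI)
    (hδ : 0 < δ) (hγH : 0 < γH) (hαH : 0 < αH) (hε0 : 0 ≤ ε) (hε1 : ε ≤ 1)
    (R₀ Sstar Istar Hstar : ℝ)
    (hR₀ : R₀ = β * Λ * ((γH + μ + αH) + ε * δ) /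
      (μ * (αI + γI + μ + δ) * (γH + μ + αH)))
    (hR₀gt : 1 < R₀)
    (hSstar : Sstar = (αI + γI + μ + δ) * (γH + μ + αH) /
      (β * ((γH + μ + αH) + ε * δ)))
    (hIstar : Istar = (γH + μ + αH) * (Λ - μ * Sstar) /
      ((γI + μ + δ) * (γH + μ + αH) - αH * δ))
    (hHstar : Hstar = δ * Istar / (γH + μ + αH))
    (J : Matrix (Fin 3) (Fin 3) ℝ)
    (hJ : J = !![-(β * Istar) - β * ε * Hstar - μ, -(β * Sstar) + αI, -(β * ε * Sstar) + αH;
                 β * Istar + β * ε * Hstar, β * Sstar - (αI + γI + μ + δ), β * ε * Sstar;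
                 0, δ, -(γH + μ + αH)])
    (a₁ a₂ a₃ : ℝ)
    (hchar : J.charpoly = X ^ 3 + C a₁ * X ^ 2 + C a₂ * X + C a₃) :
    0 < a₁ ∧ 0 < a₃ ∧ 0 < a₁ * a₂ - a₃ := by
  have hev : ∀ x : ℝ, (Matrix.scalar (Fin 3) x - J).det = x ^ 3 + a₁ * x ^ 2 + a₂ * x + a₃ := by
    intro x
    rw [← Matrix.eval_charpoly, hchar]
    simp
  have hB : 0 < γH + μ + αH := by positivity
  have hA : 0 < αI + γI + μ + δ := by positivity
  have hE : 0 < (γH + μ + αH) + ε * δ := by positivity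
  have hD : 0 < (γI + μ + δ) * (γH + μ + αH) - αH * δ := by
    have : (γI + μ + δ) * (γH + μ + αH) - αH * δ
      = (γI + μ) * (γH + μ + αH) + δ * (γH + μ) := by ring
    rw [this]; positivity
  have hS : β * Sstar * ((γH + μ + αH) + ε * δ) = (αI + γI + μ + δ) * (γH + μ + αH) := by
    rw [hSstar]; field_simp
  have hLS : 0 < Λ - μ * Sstar := by
    rw [hR₀, one_lt_div (by positivity)] at hR₀gt
    rw [hSstar, sub_pos, ← mul_div_assoc, div_lt_iff₀ (by positivity)]
    linarith
  have hI : 0 < Istar := by rw [hIstar]; positivity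
  have hH : 0 < Hstar := by rw [hHstar]; positivity
  have hs : 0 < β * Sstar := by rw [hSstar]; positivity
  have hF : 0 < β * Istar + β * ε * Hstar := by positivity
  clear hHstar hIstar hSstar hchar hR₀gt hR₀
  obtain ⟨F, hFd⟩ : ∃ F, F = β * Istar + β * ε * Hstar := ⟨_, rfl⟩
  obtain ⟨s, hsd⟩ : ∃ s, s = β * Sstar := ⟨_, rfl⟩
  obtain ⟨B, hBd⟩ : ∃ B, B = γH + μ + αH := ⟨_, rfl⟩
  obtain ⟨k, hk⟩ : ∃ k, k = αI + γI + μ + δ - s := ⟨_, rfl⟩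
  have hJ' : J = !![-F - μ, -s + αI, -(ε * s) + αH; F, -k, ε * s; 0, δ, -B] := by
    rw [hJ, hk, hFd, hsd, hBd]
    ext i j
    fin_cases i <;> fin_cases j <;> simp <;> ring
  rw [← hFd] at hF
  rw [← hsd] at hs hS
  rw [← hBd] at hB hD hS
  have hkB : k * B = ε * δ * s := by rw [hk]; linarith
  have hk0 : 0 ≤ k := by
    have : 0 ≤ k * B := by rw [hkB]; positivity
    exact nonneg_of_mul_nonneg_left this hB
  have h0 := hev 0
  have h1 := hev 1
  have h2 := hev (-1)
  simp [hJ', Matrix.det_fin_three] at h0 h1 h2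
  have e1 : a₁ = F + μ + k + B := by linarith
  have e3 : a₃ = F * ((γI + μ + δ) * B - αH * δ) := by
    linear_combination (-1) * h0 + (μ) * hkB + F * B * hk
  have e2 : a₂ = μ * k + F * (γI + μ + δ) + (F + μ) * B := by
    linear_combination (-1/2) * h1 + (1/2) * h2 + hkB + F * hk
  refine ⟨by rw [e1]; positivity, by rw [e3]; positivity, ?_⟩
  have : a₁ * a₂ - a₃ = (F + μ + k) * a₂ + B * (μ * k + (F + μ) * B) + F * (αH * δ) := by
    rw [e1, e3, e2]; ring
  rw [this, e2]
  positivity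
end

section
/- Assume R₀ = βΛ[(γH+μ+αH) + εδ] / (μ(αI+γI+μ+δ)(γH+μ+αH)) > 1, and let (S*, I*, H*) be the disease-endemic equilibrium given by S* = (αI+γI+μ+δ)(γH+μ+αH) / (β[(γH+μ+αH) + εδ]), I* = (γH+μ+αH)(Λ − μS*) / ((γI+μ+δ)(γH+μ+αH) − αH·δ), H* = δI*/(γH+μ+αH). Then every complex root of the characteristic polynomial of the Jacobian J(S*, I*, H*) = [[−βI* − βεH* − μ, −βS* + αI, −βεS* + αH], [βI* + βεH*, βS* − (αI+γI+μ+δ), βεS*], [0, δ, −(γH+μ+αH)]] has negative real part; i.e., the disease-endemic equilibrium is locally asymptotically stable. -/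
/-- Routh-Hurwitz for cubics. -/
theorem cubic_hurwitz (A b c : ℝ) (hA : 0 < A) (hb : 0 < b) (hc : 0 < c) (h : c < A * b)
    (z : ℂ) (hz : z ^ 3 + A * z ^ 2 + b * z + c = 0) : z.re < 0 := by
  by_contra! hu
  obtain ⟨u, v⟩ := z
  have h1 := congrArg Complex.re hz
  have h2 := congrArg Complex.im hz
  simp [pow_succ] at h1 h2 hu
  have h3 : v * (3 * u ^ 2 - v ^ 2 + 2 * A * u + b) = 0 := by linear_combination h2
  rcases mul_eq_zero.mp h3 with hv | hv
  · subst hv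
    have : 0 < u * u * u + A * (u * u) + b * u + c := by positivity
    nlinarith
  · have hv' : v ^ 2 = 3 * u ^ 2 + 2 * A * u + b := by linear_combination -hv
    have h4 : 8 * u ^ 3 + 8 * A * u ^ 2 + (2 * b + 2 * A ^ 2) * u + (A * b - c) = 0 := by
      linear_combination -h1 - (3 * u + A) * hv'
    have : 0 < A * b - c := by linarith
    have : 0 < 8 * u ^ 3 + 8 * A * u ^ 2 + (2 * b + 2 * A ^ 2) * u + (A * b - c) := by positivity
    linarith

/-- If `R₀ > 1`, every complex root of the characteristic polynomial of the
Jacobian at the disease-endemic equilibrium has negative real part; i.e., the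
disease-endemic equilibrium is locally asymptotically stable. -/
theorem sishd_dee_locally_stable
    (Λ μ β ε αI γI δ γH αH : ℝ)
    (hΛ : 0 < Λ) (hμ : 0 < μ) (hβ : 0 < β) (hαI : 0 < αI) (hγI : 0 < γI)
    (hδ : 0 < δ) (hγH : 0 < γH) (hαH : 0 < αH) (hε0 : 0 ≤ ε) (hε1 : ε ≤ 1)
    (R₀ Sstar Istar Hstar : ℝ)
    (hR₀ : R₀ = β * Λ * ((γH + μ + αH) + ε * δ) /
      (μ * (αI + γI + μ + δ) * (γH + μ + αH)))
    (hR₀gt : 1 < R₀)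
    (hSstar : Sstar = (αI + γI + μ + δ) * (γH + μ + αH) /
      (β * ((γH + μ + αH) + ε * δ)))
    (hIstar : Istar = (γH + μ + αH) * (Λ - μ * Sstar) /
      ((γI + μ + δ) * (γH + μ + αH) - αH * δ))
    (hHstar : Hstar = δ * Istar / (γH + μ + αH))
    (J : Matrix (Fin 3) (Fin 3) ℝ)
    (hJ : J = !![-(β * Istar) - β * ε * Hstar - μ, -(β * Sstar) + αI, -(β * ε * Sstar) + αH;
                 β * Istar + β * ε * Hstar, β * Sstar - (αI + γI + μ + δ), β * ε * Sstar;
                 0, δ, -(γH + μ + αH)]) :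
    ∀ z : ℂ, Polynomial.aeval z J.charpoly = 0 → z.re < 0 := by
  intro z hz
  obtain ⟨h, hh⟩ : ∃ h, h = γH + μ + αH := ⟨_, rfl⟩
  have hhp : 0 < h := by rw [hh]; positivity
  have hD : 0 < (γI + μ + δ) * h - αH * δ := by
    have : (γI + μ + δ) * h - αH * δ = (γI + μ) * h + δ * (γH + μ) := by rw [hh]; ring
    rw [this]; positivity
  rw [← hh] at hR₀ hSstar hIstar hHstar hJ
  have hT : 0 < h + ε * δ := by positivity
  have hΛS : 0 < Λ - μ * Sstar := by
    rw [hR₀, lt_div_iff₀ (by positivity)] at hR₀gt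
    rw [hSstar, sub_pos, ← mul_div_assoc, div_lt_iff₀ (by positivity)]
    linarith
  have hI : 0 < Istar := by rw [hIstar]; positivity
  have hH : 0 < Hstar := by rw [hHstar]; positivity
  have hS : β * Sstar * (h + ε * δ) = (αI + γI + μ + δ) * h := by
    rw [hSstar]; field_simp
  have hSp : 0 < Sstar := by rw [hSstar]; positivity
  obtain ⟨x, hx⟩ : ∃ x, x = β * Istar + β * ε * Hstar := ⟨_, rfl⟩
  have hxp : 0 < x := by rw [hx]; positivity
  obtain ⟨s, hs⟩ : ∃ s, s = β * Sstar := ⟨_, rfl⟩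
  have hsp : 0 < s := by rw [hs]; positivity
  obtain ⟨m, hm⟩ : ∃ m, m = αI + γI + μ + δ - s := ⟨_, rfl⟩
  have hmh : m * h = ε * s * δ := by rw [hm, hs]; linear_combination -hS
  have hm0 : 0 ≤ m := by
    have : 0 ≤ m * h := by rw [hmh]; positivity
    exact nonneg_of_mul_nonneg_left this hhp
  have hJ' : J = !![-x - μ, -s + αI, -(ε * s) + αH; x, -m, ε * s; 0, δ, -h] := by
    rw [hJ, hm, hs, hx]
    ext i j
    fin_cases i <;> fin_cases j <;> simp <;> ring
  refine cubic_hurwitz (x + μ + m + h) (μ * (m + h) + x * (h + γI + μ + δ))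
    (x * ((γI + μ + δ) * h - αH * δ)) (by positivity) (by positivity) (by positivity) ?_ z ?_
  · have h1 : x * ((γI + μ + δ) * h - αH * δ) < h * (x * (h + γI + μ + δ)) := by
      have : 0 < x * (αH * δ) + h * x * h := by positivity
      linarith
    have h2 : 0 ≤ (x + μ + m) * (μ * (m + h) + x * (h + γI + μ + δ)) + h * (μ * (m + h)) := by
      positivity
    linarith
  · rw [← hz, hJ', Matrix.charpoly, Matrix.det_fin_three]
    have hmh' : (m : ℂ) * h = ε * s * δ := by exact_mod_cast hmh
    have hm' : (m : ℂ) = αI + γI + μ + δ - s := by exact_mod_cast hm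
    simp
    linear_combination -(z + μ) * hmh' - x * (h + z) * hm'
end
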